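/- arXiv:2412.11354 — 6 statements merged into one kernel-verified Lean document; each statement's English description precedes it below -/
import Mathlib

section
/- Let (S, F) be a sheaved space valued in an abelian category V and let v be a beat element of (S, F). Set S' = S \ {v}. Then the canonical inclusion S' ↪ S induces a natural isomorphism H^n(X_S, F) ≅ H^n(X_{S'}, F|_{S'}) for every n ≥ 0. -/
open CategoryTheory CategoryTheory.Limits ZeroObject

universe v u

variable {V : Type u} [Category.{v} V]

/- A finite poset `S` is viewed as the Alexandrov topological space `X_S` whose open sets
are the upper sets; a sheaf on `X_S` valued in `V` is the same thing as a functor `S ⥤ V`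
(stalks `F(s)` together with restriction maps `res^s_t : F(s) ⟶ F(t)` for `s ≤ t`). -/

/-- The inclusion of a subposet (cut out by a predicate) as a functor. -/
def posetIncl {S : Type} [Preorder S] (p : S → Prop) : {x : S // p x} ⥤ S :=
  Monotone.functor (f := (Subtype.val : {x : S // p x} → S)) (fun _ _ h => h)

/-- The restriction (pullback along the canonical inclusion) of a sheaf to a subposet. -/
def restrictSheaf {S : Type} [Preorder S] (p : S → Prop) (F : S ⥤ V) :
    {x : S // p x} ⥤ V :=
  posetIncl p ⋙ F

noncomputable instance limAdditive (S : Type) [Preorder S] [Abelian V]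
    [HasLimitsOfShape S V] : (lim : (S ⥤ V) ⥤ V).Additive :=
  Functor.additive_of_preserves_binary_products _

/-- Sheaf cohomology `H^n(X_S, -)` of the Alexandrov space of the poset `S`, defined as the
`n`-th right derived functor of the global sections functor `Γ(X_S, -) = lim`. -/
noncomputable def posetSheafCohomology (S : Type) [Preorder S] [Abelian V]
    [HasLimitsOfShape S V] [HasInjectiveResolutions (S ⥤ V)] (n : ℕ) : (S ⥤ V) ⥤ V :=
  (lim : (S ⥤ V) ⥤ V).rightDerived n

/-- `v` is a downbeat point of `S`: there is `a < v` such that every `b < v` satisfies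
`b ≤ a`. -/
def IsDownbeat {S : Type} [Preorder S] (v : S) : Prop :=
  ∃ a, a < v ∧ ∀ b, b < v → b ≤ a

/-- `v` is an upbeat point of the sheaved space `(S, F)`: there is `a > v` such that every
`b > v` satisfies `b ≥ a`, and the restriction map `F(v) ⟶ F(a)` is an isomorphism. -/
def IsUpbeat {S : Type} [Preorder S] (F : S ⥤ V) (v : S) : Prop :=
  ∃ a, ∃ h : v < a, (∀ b, v < b → a ≤ b) ∧ IsIso (F.map (homOfLE h.le))

/-- A beat point of a sheaved space is an upbeat or a downbeat point. -/
def IsBeat {S : Type} [Preorder S] (F : S ⥤ V) (v : S) : Prop :=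
  IsUpbeat F v ∨ IsDownbeat v

namespace CategoryTheory

/-- An additive functor which preserves homology and injective objects sends an injective
resolution of `Z` to an injective resolution of `T.obj Z`. -/
noncomputable def Functor.mapInjectiveResolution {C : Type*} [Category* C] [HasZeroObject C]
    [Preadditive C] {D : Type*} [Category* D] [HasZeroObject D] [Preadditive D]
    [CategoryWithHomology D] (T : C ⥤ D) [T.Additive] [T.PreservesInjectiveObjects]
    [T.PreservesHomology] {Z : C} (I : InjectiveResolution Z) :
    InjectiveResolution (T.obj Z) where
  cocomplex := (T.mapHomologicalComplex _).obj I.cocomplex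
  injective n := T.injective_obj_of_injective (I.injective n)
  ι := (HomologicalComplex.singleMapHomologicalComplex _ _ _).inv.app _ ≫
    (T.mapHomologicalComplex _).map I.ι
  quasiIso := inferInstance

/-- If `T` is exact and preserves injective objects, and `T ⋙ G ≅ H`, then the right derived
functors of `G` at `T.obj X` agree with those of `H` at `X`. -/
noncomputable def Functor.rightDerivedObjIsoOfCompIso {C D E : Type*} [Category* C]
    [Category* D] [Category* E] [Abelian C] [Abelian D] [Abelian E]
    [HasInjectiveResolutions C] [HasInjectiveResolutions D]
    (T : C ⥤ D) [T.Additive] [T.PreservesInjectiveObjects] [T.PreservesHomology]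
    {G : D ⥤ E} {H : C ⥤ E} [G.Additive] [H.Additive] (e : T ⋙ G ≅ H) (X : C) (n : ℕ) :
    (G.rightDerived n).obj (T.obj X) ≅ (H.rightDerived n).obj X :=
  let I := injectiveResolution X
  (T.mapInjectiveResolution I).isoRightDerivedObj G n ≪≫
    (HomologicalComplex.homologyFunctor E _ n).mapIso
      ((mapHomologicalComplexCompIso e (ComplexShape.up ℕ)).app I.cocomplex) ≪≫
    (I.isoRightDerivedObj H n).symm

/-- Restriction of functors along a left adjoint preserves injective objects. -/
lemma Adjunction.preservesInjectiveObjects_whiskeringLeft {C D : Type*} [Category* C]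
    [Category* D] [HasPullbacks V] {L : C ⥤ D} {R : D ⥤ C} (adj : L ⊣ R) :
    ((Functor.whiskeringLeft C D V).obj L).PreservesInjectiveObjects :=
  Functor.preservesInjectiveObjects_of_adjunction_of_preservesMonomorphisms (adj.whiskerLeft V)

end CategoryTheory

/-- Restriction along a left adjoint of posets preserves sheaf cohomology. -/
noncomputable def posetSheafCohomologyObjIsoOfAdjunction [Abelian V] {S T : Type} [Preorder S]
    [Preorder T] [HasLimitsOfShape S V] [HasLimitsOfShape T V]
    [HasInjectiveResolutions (S ⥤ V)] [HasInjectiveResolutions (T ⥤ V)]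
    {L : S ⥤ T} {R : T ⥤ S} (adj : L ⊣ R) (F : T ⥤ V) (n : ℕ) :
    (posetSheafCohomology S n).obj (L ⋙ F) ≅ (posetSheafCohomology T n).obj F :=
  haveI := adj.preservesInjectiveObjects_whiskeringLeft (V := V)
  haveI := Functor.initial_of_adjunction adj
  ((Functor.whiskeringLeft S T V).obj L).rightDerivedObjIsoOfCompIso
    (Functor.Initial.limIso L) F n

/-- If `v` is downbeat, witnessed by `a`, the inclusion of `S \ {v}` is left adjoint to the
retraction sending `v` to `a`. -/
lemma IsDownbeat.exists_adjunction {S : Type} [PartialOrder S] {v : S} (hv : IsDownbeat v) :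
    ∃ R : S ⥤ {x : S // x ≠ v}, Nonempty (posetIncl (· ≠ v) ⊣ R) := by
  classical
  obtain ⟨a, hav, ha⟩ := hv
  have gc : GaloisConnection (Subtype.val : {x : S // x ≠ v} → S)
      (fun s => if h : s = v then ⟨a, hav.ne⟩ else ⟨s, h⟩) := by
    rintro ⟨x, hx⟩ s
    by_cases h : s = v
    · subst h
      simpa using ⟨fun hxs => ha x (lt_of_le_of_ne hxs hx), fun hxa => hxa.trans hav.le⟩
    · simp [h]
  exact ⟨_, ⟨gc.adjunction⟩⟩

/-- If `v` is upbeat, witnessed by `a`, the inclusion of `S \ {v}` is right adjoint to the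
retraction sending `v` to `a`, and `F` inverts the unit of this adjunction. -/
lemma IsUpbeat.exists_adjunction {S : Type} [PartialOrder S] {F : S ⥤ V} {v : S}
    (hv : IsUpbeat F v) :
    ∃ (L : S ⥤ {x : S // x ≠ v}) (adj : L ⊣ posetIncl (· ≠ v)),
      ∀ s, IsIso (F.map (adj.unit.app s)) := by
  classical
  obtain ⟨a, hva, ha, hF⟩ := hv
  have gc : GaloisConnection
      (fun s => if h : s = v then ⟨a, hva.ne'⟩ else ⟨s, h⟩)
      (Subtype.val : {x : S // x ≠ v} → S) := by
    rintro s ⟨x, hx⟩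
    by_cases h : s = v
    · subst h
      simpa using ⟨fun hax => hva.le.trans hax, fun hsx => ha x (lt_of_le_of_ne hsx hx.symm)⟩
    · simp [h]
  have key : ∀ (s t : S) (f : s ⟶ t), t = (if s = v then a else s) → IsIso (F.map f) := by
    rintro s t f rfl
    by_cases h : s = v
    · subst h
      generalize hb : (if s = s then a else s) = b at f
      obtain rfl : a = b := by simpa using hb
      exact hF
    · generalize hb : (if s = v then a else s) = b at f
      obtain rfl : s = b := by simpa [h] using hb
      rw [Subsingleton.elim f (𝟙 s)]
      infer_instance
  refine ⟨_, gc.adjunction, fun s => key _ _ _ ?_⟩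
  by_cases h : s = v <;> simp [h] <;> rfl

/-- If `v` is a beat element of the sheaved space `(S, F)` and
`S' = S \ {v}`, then the canonical inclusion `S' ↪ S` induces a natural isomorphism
`H^n(X_S, F) ≅ H^n(X_{S'}, F|_{S'})` for every `n ≥ 0`. -/
theorem beat_collapse_cohomology_iso
    [Abelian V] {S : Type} [PartialOrder S] [Fintype S]
    [HasLimitsOfShape S V] [HasInjectiveResolutions (S ⥤ V)]
    (F : S ⥤ V) (v : S)
    [HasLimitsOfShape {x : S // x ≠ v} V]
    [HasInjectiveResolutions ({x : S // x ≠ v} ⥤ V)]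
    (hv : IsBeat F v) (n : ℕ) :
    Nonempty ((posetSheafCohomology S n).obj F ≅
      (posetSheafCohomology {x : S // x ≠ v} n).obj (restrictSheaf (· ≠ v) F)) := by
  obtain hv | hv := hv
  · obtain ⟨L, adj, hadj⟩ := hv.exists_adjunction
    have : ∀ s, IsIso ((Functor.whiskerRight adj.unit F).app s) := hadj
    have := NatIso.isIso_of_isIso_app (Functor.whiskerRight adj.unit F)
    let e : F ≅ L ⋙ restrictSheaf (· ≠ v) F :=
      F.leftUnitor.symm ≪≫ @asIso _ _ _ _ (Functor.whiskerRight adj.unit F) this ≪≫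
        Functor.associator _ _ _
    exact ⟨(posetSheafCohomology S n).mapIso e ≪≫
      posetSheafCohomologyObjIsoOfAdjunction adj (restrictSheaf (· ≠ v) F) n⟩
  · obtain ⟨R, ⟨adj⟩⟩ := hv.exists_adjunction
    exact ⟨(posetSheafCohomologyObjIsoOfAdjunction adj F n).symm⟩
end

section
/- Let (S, F) be a sheaved space valued in an abelian category V and let v ∈ S be a downbeat element. Set S' = S \ {v}. Then the canonical inclusion S' ↪ S induces a natural isomorphism of global sections Γ(X_S, F) ≅ Γ(X_{S'}, F|_{S'}). -/
open CategoryTheory CategoryTheory.Limits ZeroObject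

universe v u

variable {V : Type u} [Category.{v} V]

/-- If every element below `v` other than `v` is below `a`, then the inclusion `S \ {v} ↪ S` is the
lower adjoint of the map collapsing `v` onto `a`. -/
theorem galoisConnection_val_collapse {S : Type} [PartialOrder S] [DecidableEq S] {a v : S}
    (hav : a < v) (h : ∀ b, b < v → b ≤ a) :
    GaloisConnection (Subtype.val : {x : S // x ≠ v} → S)
      (fun s => if hs : s = v then ⟨a, hav.ne⟩ else ⟨s, hs⟩) := by
  rintro ⟨x, hx⟩ s
  by_cases hs : s = v
  · subst hs
    simpa using ⟨fun hxs => h x (lt_of_le_of_ne hxs hx), fun hxa => hxa.trans hav.le⟩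
  · simp [hs]

/-- Removing a downbeat point gives an initial inclusion. -/
theorem IsDownbeat.initial_posetIncl {S : Type} [PartialOrder S] {v : S} (hv : IsDownbeat v) :
    (posetIncl (· ≠ v)).Initial := by
  classical
  obtain ⟨a, hav, h⟩ := hv
  exact Functor.initial_of_adjunction (galoisConnection_val_collapse hav h).adjunction

/-- If `v` is a downbeat element of the sheaved space `(S, F)` and `S' = S \ {v}`, then the canonical
inclusion `S' ↪ S` induces a natural isomorphism of global sections
`Γ(X_S, F) ≅ Γ(X_{S'}, F|_{S'})`.  Here `Γ = lim` and the induced map is the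
canonical comparison map `limit.pre` of limits along the inclusion functor. -/
theorem collapse_global_sections_iso_1
    [Abelian V] {S : Type} [PartialOrder S] [Fintype S]
    [HasLimitsOfShape S V] (F : S ⥤ V) (v : S)
    [HasLimitsOfShape {x : S // x ≠ v} V]
    (hv : IsDownbeat v) :
    IsIso (limit.pre F (posetIncl (· ≠ v))) := by
  have := hv.initial_posetIncl
  infer_instance
end

section
/- Let (S, F) be a sheaved space valued in an abelian category V and let v ∈ S be an upbeat element of (S, F), i.e. there exists a > v such that every b > v satisfies b ≥ a and res^v_a : F(v) → F(a) is an isomorphism. Set S' = S \ {v}. Then the canonical inclusion S' ↪ S induces a natural isomorphism of global sections Γ(X_S, F) ≅ Γ(X_{S'}, F|_{S'}). -/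
open CategoryTheory CategoryTheory.Limits ZeroObject

universe v u

variable {V : Type u} [Category.{v} V]

/-- A cone over `F` restricted to the complement of `v` extends to a cone over `F` with the same
apex when `v` is upbeat. -/
theorem exists_cone_extension_of_isUpbeat {S : Type} [PartialOrder S] {F : S ⥤ V} {v : S}
    (hv : IsUpbeat F v) (c : Cone (posetIncl (· ≠ v) ⋙ F)) :
    ∃ f : (Functor.const S).obj c.pt ⟶ F, ∀ x : {x : S // x ≠ v}, f.app x.1 = c.π.app x := by
  classical
  obtain ⟨a, hva, hmin, hiso⟩ := hv
  let q (x : {x : S // x ≠ v}) : c.pt ⟶ F.obj x.1 := c.π.app x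
  have hnat : ∀ (x y : {x : S // x ≠ v}) (h : x.1 ≤ y.1),
      q x ≫ F.map (homOfLE h) = q y := fun x y h =>
    c.w (homOfLE (show x ≤ y from h))
  obtain ⟨f, hf, hfv⟩ : ∃ f : ∀ x, c.pt ⟶ F.obj x,
      (∀ x : {x : S // x ≠ v}, f x.1 = q x) ∧
        f v ≫ F.map (homOfLE hva.le) = q ⟨a, hva.ne'⟩ := by
    refine ⟨fun x => if h : x = v then
      q ⟨a, hva.ne'⟩ ≫ inv (F.map (homOfLE hva.le)) ≫ eqToHom (by rw [h]) else q ⟨x, h⟩,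
      fun x => dif_neg x.2, ?_⟩
    simp
  have hf_map : ∀ (x y : S) (h : x ≤ y), f x ≫ F.map (homOfLE h) = f y := by
    intro x y h
    by_cases hx : x = v
    · subst hx
      by_cases hy : y = x
      · subst hy
        exact (congrArg _ (F.map_id _)).trans (Category.comp_id _)
      · have hay := hmin y (lt_of_le_of_ne h (Ne.symm hy))
        rw [← homOfLE_comp hva.le hay, F.map_comp, ← Category.assoc, hfv, hf ⟨y, hy⟩]
        exact hnat ⟨a, hva.ne'⟩ ⟨y, hy⟩ hay
    · by_cases hy : y = v
      · subst hy
        rw [← cancel_mono (F.map (homOfLE hva.le)), Category.assoc, ← F.map_comp,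
          homOfLE_comp, hfv, hf ⟨x, hx⟩]
        exact hnat ⟨x, hx⟩ ⟨a, hva.ne'⟩ (h.trans hva.le)
      · rw [hf ⟨x, hx⟩, hf ⟨y, hy⟩]
        exact hnat ⟨x, hx⟩ ⟨y, hy⟩ h
  exact ⟨{ app := f
           naturality := fun x y g => (Category.id_comp _).trans (hf_map x y (leOfHom g)).symm }, hf⟩

/-- Morphisms into `limit F` are determined by their components away from an upbeat point. -/
theorem hom_ext_limit_of_isUpbeat {S : Type} [PartialOrder S] {F : S ⥤ V} [HasLimit F] {v : S}
    (hv : IsUpbeat F v) {W : V} {f g : W ⟶ limit F}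
    (h : ∀ x, x ≠ v → f ≫ limit.π F x = g ≫ limit.π F x) : f = g := by
  obtain ⟨a, hva, -, hiso⟩ := hv
  refine limit.hom_ext fun x => ?_
  by_cases hx : x = v
  · subst hx
    rw [← cancel_mono (F.map (homOfLE hva.le)), Category.assoc, Category.assoc, limit.w]
    exact h a hva.ne'
  · exact h x hx

/-- If `v` is an upbeat element of the sheaved space `(S, F)` and `S' = S \ {v}`, then the canonical
inclusion `S' ↪ S` induces a natural isomorphism of global sections
`Γ(X_S, F) ≅ Γ(X_{S'}, F|_{S'})`.  Here `Γ = lim` and the induced map is the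
canonical comparison map `limit.pre` of limits along the inclusion functor. -/
theorem collapse_global_sections_iso_2
    [Abelian V] {S : Type} [PartialOrder S] [Fintype S]
    [HasLimitsOfShape S V] (F : S ⥤ V) (v : S)
    [HasLimitsOfShape {x : S // x ≠ v} V]
    (hv : IsUpbeat F v) :
    IsIso (limit.pre F (posetIncl (· ≠ v))) := by
  obtain ⟨f, hf⟩ :=
    exists_cone_extension_of_isUpbeat hv (limit.cone (posetIncl (· ≠ v) ⋙ F))
  have hpre : ∀ x : {x : S // x ≠ v},
      limit.pre F (posetIncl (· ≠ v)) ≫ limit.π (posetIncl (· ≠ v) ⋙ F) x = limit.π F x.1 :=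
    fun x => limit.pre_π F (posetIncl (· ≠ v)) x
  have hlift : ∀ x : {x : S // x ≠ v},
      limit.lift F ⟨_, f⟩ ≫ limit.π F x.1 = limit.π (posetIncl (· ≠ v) ⋙ F) x :=
    fun x => (limit.lift_π _ _).trans (hf x)
  refine ⟨limit.lift F ⟨_, f⟩, ?_, ?_⟩
  · refine hom_ext_limit_of_isUpbeat hv fun x hx => ?_
    rw [Category.assoc, Category.id_comp]
    exact (congrArg _ (hlift ⟨x, hx⟩)).trans (hpre ⟨x, hx⟩)
  · refine limit.hom_ext fun x => ?_
    rw [Category.assoc, Category.id_comp, hpre]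
    exact hlift x
end

section
/- Let (S, F) be a sheaved space valued in an abelian category V and let v ∈ S be a beat element of (S, F). Set S' = S \ {v}. Then the canonical inclusion S' ↪ S induces a natural isomorphism of global sections Γ(X_S, F) ≅ Γ(X_{S'}, F|_{S'}). -/
open CategoryTheory CategoryTheory.Limits ZeroObject

universe v u

variable {V : Type u} [Category.{v} V]

/-- The projection from the sections over `S \ {v}` to the stalk of `F` at `s ≠ v`. -/
noncomputable def restrictedProj {S : Type} [PartialOrder S] (F : S ⥤ V) (v : S)
    [HasLimitsOfShape {x : S // x ≠ v} V] (s : {x : S // x ≠ v}) :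
    limit (posetIncl (· ≠ v) ⋙ F) ⟶ F.obj s.1 :=
  limit.π (posetIncl (· ≠ v) ⋙ F) s

theorem restrictedProj_map {S : Type} [PartialOrder S] (F : S ⥤ V) (v : S)
    [HasLimitsOfShape {x : S // x ≠ v} V] (s t : {x : S // x ≠ v}) (f : s.1 ⟶ t.1) :
    restrictedProj F v s ≫ F.map f = restrictedProj F v t :=
  limit.w (posetIncl (· ≠ v) ⋙ F) (homOfLE f.le : s ⟶ t)

theorem limit_pre_restrictedProj {S : Type} [PartialOrder S] [HasLimitsOfShape S V]
    (F : S ⥤ V) (v : S) [HasLimitsOfShape {x : S // x ≠ v} V] (s : {x : S // x ≠ v}) :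
    limit.pre F (posetIncl (· ≠ v)) ≫ restrictedProj F v s = limit.π F s.1 :=
  limit.pre_π F (posetIncl (· ≠ v)) s

/-- If the limit of the restriction of `F` to `S \ {v}` has a projection to `F(v)` compatible with
the restriction maps of `F` and with the projection of `lim F`, then restriction to `S \ {v}`
induces an isomorphism of limits. -/
theorem isIso_limit_pre_of_projection {S : Type} [PartialOrder S] [HasLimitsOfShape S V]
    (F : S ⥤ V) (v : S) [HasLimitsOfShape {x : S // x ≠ v} V]
    (e : limit (posetIncl (· ≠ v) ⋙ F) ⟶ F.obj v)
    (below : ∀ (b : {x : S // x ≠ v}) (h : b.1 ⟶ v),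
      restrictedProj F v b ≫ F.map h = e)
    (above : ∀ (c : {x : S // x ≠ v}) (h : v ⟶ c.1),
      e ≫ F.map h = restrictedProj F v c)
    (pre_comp : limit.pre F (posetIncl (· ≠ v)) ≫ e = limit.π F v) :
    IsIso (limit.pre F (posetIncl (· ≠ v))) := by
  classical
  have extends_to_cone : ∃ π : ∀ s, limit (posetIncl (· ≠ v) ⋙ F) ⟶ F.obj s,
      π v = e ∧ ∀ s : {x : S // x ≠ v}, π s.1 = restrictedProj F v s := by
    refine ⟨fun s => if h : s = v then e ≫ eqToHom (by rw [h])
      else restrictedProj F v ⟨s, h⟩, by simp, fun s => dif_neg s.2⟩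
  obtain ⟨π, π_self, π_ne⟩ := extends_to_cone
  have naturality : ∀ {s t : S} (f : s ⟶ t), π s ≫ F.map f = π t := by
    intro s t f
    by_cases hs : s = v
    · subst hs
      by_cases ht : t = s
      · subst ht
        rw [Subsingleton.elim f (𝟙 t), F.map_id, Category.comp_id]
      · rw [π_self, π_ne ⟨t, ht⟩]
        exact above ⟨t, ht⟩ f
    · by_cases ht : t = v
      · subst ht
        rw [π_self, π_ne ⟨s, hs⟩]
        exact below ⟨s, hs⟩ f
      · rw [π_ne ⟨s, hs⟩, π_ne ⟨t, ht⟩]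
        exact restrictedProj_map F v ⟨s, hs⟩ ⟨t, ht⟩ f
  let c : Cone F :=
    { pt := limit (posetIncl (· ≠ v) ⋙ F)
      π := { app := π, naturality := fun _ _ f => by simp [naturality f] } }
  refine ⟨limit.lift F c, limit.hom_ext fun s => ?_, limit.hom_ext fun s => ?_⟩
  · rw [Category.assoc, limit.lift_π, Category.id_comp]
    change _ ≫ π s = _
    by_cases hs : s = v
    · subst hs
      rw [π_self, pre_comp]
    · rw [π_ne ⟨s, hs⟩]
      exact limit_pre_restrictedProj F v ⟨s, hs⟩
  · rw [Category.assoc, limit.pre_π, Category.id_comp]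
    exact (limit.lift_π c s.1).trans (π_ne s)

/-- If `v` is a beat element of the sheaved space `(S, F)` and `S' = S \ {v}`, then the canonical
inclusion `S' ↪ S` induces a natural isomorphism of global sections
`Γ(X_S, F) ≅ Γ(X_{S'}, F|_{S'})`.  Here `Γ = lim` and the induced map is the
canonical comparison map `limit.pre` of limits along the inclusion functor. -/
theorem collapse_global_sections_iso_3
    [Abelian V] {S : Type} [PartialOrder S] [Fintype S]
    [HasLimitsOfShape S V] (F : S ⥤ V) (v : S)
    [HasLimitsOfShape {x : S // x ≠ v} V]
    (hv : IsBeat F v) :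
    IsIso (limit.pre F (posetIncl (· ≠ v))) := by
  rcases hv with ⟨a, hva, ha, _⟩ | ⟨a, hav, ha⟩
  · let a' : {x : S // x ≠ v} := ⟨a, hva.ne'⟩
    refine isIso_limit_pre_of_projection F v
      (restrictedProj F v a' ≫ inv (F.map (homOfLE hva.le))) ?_ ?_ ?_
    · intro b h
      rw [IsIso.eq_comp_inv, Category.assoc, ← F.map_comp]
      exact restrictedProj_map F v b a' _
    · intro c h
      have hac : a ≤ c.1 := ha c.1 (lt_of_le_of_ne h.le c.2.symm)
      rw [Subsingleton.elim h (homOfLE hva.le ≫ homOfLE hac), F.map_comp, Category.assoc,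
        IsIso.inv_hom_id_assoc]
      exact restrictedProj_map F v a' c _
    · rw [← Category.assoc, limit_pre_restrictedProj, IsIso.comp_inv_eq]
      exact (limit.w F (homOfLE hva.le)).symm
  · let a' : {x : S // x ≠ v} := ⟨a, hav.ne⟩
    refine isIso_limit_pre_of_projection F v
      (restrictedProj F v a' ≫ F.map (homOfLE hav.le)) ?_ ?_ ?_
    · intro b h
      have hba : b.1 ≤ a := ha b.1 (lt_of_le_of_ne h.le b.2)
      rw [← restrictedProj_map F v b a' (homOfLE hba), Category.assoc, ← F.map_comp]
      rfl
    · intro c h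
      rw [Category.assoc, ← F.map_comp]
      exact restrictedProj_map F v a' c _
    · rw [← Category.assoc, limit_pre_restrictedProj]
      exact limit.w F (homOfLE hav.le)
end

section
/- Let S be a finite poset, W an injective object of an abelian category V, and s ∈ S. Let v ∈ S be a beat element of the sheaved space (S, ⌈s⌉_W) and set S' = S \ {v}. Then the restricted sheaf (⌈s⌉_W)|_{S'} is an injective object of the category of sheaves on X_{S'} valued in V. -/
open CategoryTheory CategoryTheory.Limits ZeroObject

universe v u

variable {V : Type u} [Category.{v} V]

open Classical in
/-- The sheaf on (the Alexandrov space of) `S` whose stalk is `W` at the points of the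
convex set `P` and `0` elsewhere, all restriction maps between the `W`-stalks being
identities. -/
noncomputable def stalkSheaf {S : Type} [Preorder S] [HasZeroMorphisms V] [HasZeroObject V]
    (P : S → Prop) (hP : ∀ {a b c : S}, a ≤ b → b ≤ c → P a → P c → P b) (W : V) : S ⥤ V where
  obj t := if P t then W else 0
  map {t t'} f :=
    if h1 : P t then
      (if h2 : P t' then eqToHom (if_pos h1) ≫ eqToHom (if_pos h2).symm else 0)
    else 0
  map_id t := by
    by_cases h : P t
    · simp [h]
    · have hz : IsZero (if P t then W else (0 : V)) := by
        rw [if_neg h]; exact isZero_zero V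
      exact hz.eq_of_src _ _
  map_comp {t t' t''} f g := by
    by_cases h1 : P t
    · by_cases h3 : P t''
      · have h2 : P t' := hP (leOfHom f) (leOfHom g) h1 h3
        simp [h1, h2, h3]
      · by_cases h2 : P t' <;> simp [h1, h2, h3]
    · simp [h1]

/-- The sheaf `⌈s⌉_W`, with stalk `W` at all `t ≤ s` and `0` elsewhere. -/
noncomputable def ceilSheaf {S : Type} [Preorder S] [HasZeroMorphisms V] [HasZeroObject V]
    (s : S) (W : V) : S ⥤ V :=
  stalkSheaf (· ≤ s) (fun _ hbc _ hc => hbc.trans hc) W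

/-- A functor on a preorder is injective if its value at some `s` is injective, its maps into `s`
are isomorphisms, and its values away from the elements below `s` vanish. -/
theorem injective_of_isIso_map_of_isZero [Abelian V] {P : Type} [Preorder P] (G : P ⥤ V) (s : P)
    [Injective (G.obj s)] (hiso : ∀ t (h : t ≤ s), IsIso (G.map (homOfLE h)))
    (hzero : ∀ t, ¬ t ≤ s → IsZero (G.obj t)) : Injective G where
  factors {X Y} g f _ := by
    classical
    let k : Y.obj s ⟶ G.obj s := Injective.factorThru (g.app s) (f.app s)
    have hk : f.app s ≫ k = g.app s := Injective.comp_factorThru _ _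
    let φ (t : P) : Y.obj t ⟶ G.obj t :=
      if h : t ≤ s then Y.map (homOfLE h) ≫ k ≫ @inv _ _ _ _ (G.map (homOfLE h)) (hiso t h) else 0
    have hφ (t : P) (h : t ≤ s) : φ t ≫ G.map (homOfLE h) = Y.map (homOfLE h) ≫ k := by
      have := hiso t h
      simp [φ, h]
    refine ⟨{ app := φ, naturality := fun t t' i => ?_ }, ?_⟩
    · by_cases h' : t' ≤ s
      · have := hiso t' h'
        have h : t ≤ s := i.le.trans h'
        rw [← cancel_mono (G.map (homOfLE h')), Category.assoc, Category.assoc, hφ t' h',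
          ← G.map_comp, ← Y.map_comp_assoc]
        exact (hφ t h).symm
      · exact (hzero t' h').eq_of_tgt _ _
    · ext t
      by_cases h : t ≤ s
      · have := hiso t h
        rw [← cancel_mono (G.map (homOfLE h)), NatTrans.comp_app, Category.assoc, hφ t h,
          ← f.naturality_assoc, hk, g.naturality]
      · exact (hzero t h).eq_of_tgt _ _

theorem ceilSheaf_obj_of_le [Abelian V] {S : Type} [Preorder S] {s t : S} (W : V) (h : t ≤ s) :
    (ceilSheaf s W).obj t = W :=
  if_pos h

theorem isZero_ceilSheaf_obj [Abelian V] {S : Type} [Preorder S] {s t : S} (W : V) (h : ¬ t ≤ s) :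
    IsZero ((ceilSheaf s W).obj t) := by
  have : (ceilSheaf s W).obj t = 0 := if_neg h
  rw [this]
  exact isZero_zero V

theorem isIso_ceilSheaf_map [Abelian V] {S : Type} [Preorder S] {s t t' : S} (W : V) (i : t ⟶ t')
    (h : t' ≤ s) : IsIso ((ceilSheaf s W).map i) := by
  have ht : t ≤ s := i.le.trans h
  simp only [ceilSheaf, stalkSheaf, dif_pos h, dif_pos ht]
  infer_instance

/-- The restriction of `⌈s⌉_W` to a subposet is injective when the elements of the subposet lying
below `s` have a largest element. -/
theorem injective_restrictSheaf_ceilSheaf [Abelian V] {S : Type} [Preorder S] (p : S → Prop)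
    (W : V) [Injective W] (s : S) (a : {x : S // p x}) (ha : a.1 ≤ s)
    (hmax : ∀ t : {x : S // p x}, t.1 ≤ s → t ≤ a) :
    Injective (restrictSheaf p (ceilSheaf s W)) := by
  have : Injective ((restrictSheaf p (ceilSheaf s W)).obj a) := by
    change Injective ((ceilSheaf s W).obj a.1)
    rwa [ceilSheaf_obj_of_le W ha]
  refine injective_of_isIso_map_of_isZero _ a (fun t h => ?_) (fun t h => ?_)
  · exact isIso_ceilSheaf_map W ((posetIncl p).map (homOfLE h)) ha
  · exact isZero_ceilSheaf_obj W fun h' => h (hmax t h')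

/-- Let `W` be an injective object of the abelian category `V`, `s ∈ S`,
and let `v` be a beat element of the sheaved space `(S, ⌈s⌉_W)`.  With `S' = S \ {v}`,
the restricted sheaf `(⌈s⌉_W)|_{S'}` is an injective object of the category of sheaves
on `X_{S'}` valued in `V`. -/
theorem restrict_ceilSheaf_injective
    [Abelian V] {S : Type} [PartialOrder S] [Fintype S]
    (W : V) (hW : Injective W) (s v : S)
    (hv : IsBeat (ceilSheaf s W) v) :
    Injective (restrictSheaf (· ≠ v) (ceilSheaf s W)) := by
  by_cases hsv : s = v
  · subst hsv
    rcases hv with ⟨a, ha, -, hiso⟩ | ⟨a, ha, hmax⟩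
    · have hW0 : IsZero W := by
        rw [← ceilSheaf_obj_of_le (s := s) W le_rfl]
        exact (isZero_ceilSheaf_obj W ha.not_ge).of_iso (asIso ((ceilSheaf s W).map (homOfLE ha.le)))
      have hF : IsZero (restrictSheaf (· ≠ s) (ceilSheaf s W)) := by
        refine Functor.isZero _ fun t => ?_
        by_cases ht : t.1 ≤ s
        · exact (ceilSheaf_obj_of_le W ht).symm ▸ hW0
        · exact isZero_ceilSheaf_obj W ht
      exact hF.injective
    · exact injective_restrictSheaf_ceilSheaf _ W s ⟨a, ha.ne⟩ ha.le
        fun t ht => hmax t.1 (lt_of_le_of_ne ht t.2)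
  · exact injective_restrictSheaf_ceilSheaf _ W s ⟨s, hsv⟩ le_rfl fun _ ht => ht
end

section
/- All cores of a sheaved space (S, F) are isomorphic: if (T₁, G₁) and (T₂, G₂) are both cores of (S, F), then there exists an isomorphism of posets a : T₁ → T₂ together with an isomorphism of sheaves a*G₂ ≅ G₁, i.e. (T₁, G₁) and (T₂, G₂) are isomorphic objects in the category of sheaved spaces. -/
open CategoryTheory CategoryTheory.Limits ZeroObject

universe v u

variable {V : Type u} [Category.{v} V]

/-- One step of beat collapapse on subposets of `S`: `B` is obtained from `A` by deleting a
single beat element of the sheaved space `(A, F|_A)`. -/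
def CollapseStep {S : Type} [Preorder S] (F : S ⥤ V) (A B : Set S) : Prop :=
  ∃ v : S, ∃ hv : v ∈ A, IsBeat (restrictSheaf (· ∈ A) F) ⟨v, hv⟩ ∧ B = A \ {v}

/-- `T` (with the restricted sheaf `F|_T`) is a core of the sheaved space `(S, F)`:
it is obtained from `S` by successively deleting beat elements, and `(T, F|_T)` has no
beat elements. -/
def IsCoreOf {S : Type} [Preorder S] (F : S ⥤ V) (T : Set S) : Prop :=
  Relation.ReflTransGen (CollapseStep F) Set.univ T ∧
    ∀ x : {t : S // t ∈ T}, ¬ IsBeat (restrictSheaf (· ∈ T) F) x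

/-- A morphism of sheaved posets `(S, F) ⟶ (T, G)`: a monotone map `S → T`, as a functor,
together with a morphism of sheaves from the pullback of `G` to `F`. -/
structure SheavedHom {S T : Type} [Preorder S] [Preorder T] (F : S ⥤ V) (G : T ⥤ V) where
  base : S ⥤ T
  comp : base ⋙ G ⟶ F

namespace SheavedHom

/-- The component at `x` of the sheaf morphism. -/
abbrev app {S T : Type} [Preorder S] [Preorder T] {F : S ⥤ V} {G : T ⥤ V}
    (p : SheavedHom F G) (x : S) : G.obj (p.base.obj x) ⟶ F.obj x :=
  p.comp.app x

section Basic

variable {S T U W : Type} [Preorder S] [Preorder T] [Preorder U] [Preorder W]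
  {F : S ⥤ V} {G : T ⥤ V} {H : U ⥤ V} {K : W ⥤ V}

/-- The identity morphism. -/
def id (F : S ⥤ V) : SheavedHom F F := ⟨𝟭 S, 𝟙 F⟩

/-- Composition, in diagrammatic order. -/
def trans (p : SheavedHom F G) (q : SheavedHom G H) : SheavedHom F H :=
  ⟨p.base ⋙ q.base, Functor.whiskerLeft p.base q.comp ≫ p.comp⟩

theorem trans_assoc (p : SheavedHom F G) (q : SheavedHom G H) (r : SheavedHom H K) :
    (p.trans q).trans r = p.trans (q.trans r) := by
  simp only [trans, mk.injEq]
  refine ⟨rfl, heq_of_eq ?_⟩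
  ext x
  simp

theorem id_trans (p : SheavedHom F G) : (id F).trans p = p := by
  cases p
  simp only [trans, id, mk.injEq]
  refine ⟨rfl, heq_of_eq ?_⟩
  ext x
  simp

/-- `p ≤ q` when the base maps are pointwise ordered and the sheaf map of `p` factors through
that of `q` via restriction. -/
instance : Preorder (SheavedHom F G) where
  le p q := ∃ α : p.base ⟶ q.base, ∀ x, p.comp.app x = G.map (α.app x) ≫ q.comp.app x
  le_refl p := ⟨𝟙 _, fun x => by simp⟩
  le_trans p q r := by
    rintro ⟨α, hα⟩ ⟨β, hβ⟩
    exact ⟨α ≫ β, fun x => by simp [hα, hβ]⟩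

theorem trans_le_trans_right {p q : SheavedHom F G} (h : p ≤ q) (r : SheavedHom G H) :
    p.trans r ≤ q.trans r := by
  obtain ⟨α, hα⟩ := h
  refine ⟨Functor.whiskerRight α r.base, fun x => ?_⟩
  have := r.comp.naturality (α.app x)
  simp only [Functor.comp_map] at this
  simp [trans, hα, reassoc_of% this]

theorem trans_le_trans_left (p : SheavedHom F G) {r s : SheavedHom G H} (h : r ≤ s) :
    p.trans r ≤ p.trans s := by
  obtain ⟨α, hα⟩ := h
  exact ⟨Functor.whiskerLeft p.base α, fun x => by simp [trans, hα]⟩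

/-- Homotopy: the equivalence relation generated by the order on morphisms. -/
def Homotopic (p q : SheavedHom F G) : Prop := Relation.EqvGen (· ≤ ·) p q

theorem Homotopic.trans_right {p q : SheavedHom F G} (h : p.Homotopic q)
    (r : SheavedHom G H) : (p.trans r).Homotopic (q.trans r) := by
  induction h with
  | rel _ _ h => exact .rel _ _ (trans_le_trans_right h r)
  | refl => exact .refl _
  | symm _ _ _ ih => exact .symm _ _ ih
  | trans _ _ _ _ _ ih₁ ih₂ => exact .trans _ _ _ ih₁ ih₂

theorem Homotopic.trans_left (p : SheavedHom F G) {r s : SheavedHom G H}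
    (h : r.Homotopic s) : (p.trans r).Homotopic (p.trans s) := by
  induction h with
  | rel _ _ h => exact .rel _ _ (trans_le_trans_left p h)
  | refl => exact .refl _
  | symm _ _ _ ih => exact .symm _ _ ih
  | trans _ _ _ _ _ ih₁ ih₂ => exact .trans _ _ _ ih₁ ih₂

/-- Homotopy equivalence of sheaved posets. -/
def HomotopyEquivalent (F : S ⥤ V) (G : T ⥤ V) : Prop :=
  ∃ (p : SheavedHom F G) (q : SheavedHom G F),
    (p.trans q).Homotopic (id F) ∧ (q.trans p).Homotopic (id G)

theorem HomotopyEquivalent.refl (F : S ⥤ V) : HomotopyEquivalent F F :=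
  ⟨id F, id F, by rw [id_trans]; exact .refl _, by rw [id_trans]; exact .refl _⟩

theorem HomotopyEquivalent.symm (h : HomotopyEquivalent F G) : HomotopyEquivalent G F := by
  obtain ⟨p, q, hpq, hqp⟩ := h
  exact ⟨q, p, hqp, hpq⟩

theorem Homotopic.trans_trans_trans {p : SheavedHom F G} {q : SheavedHom G F}
    {r : SheavedHom G H} {s : SheavedHom H G} (hpq : (p.trans q).Homotopic (id F))
    (hrs : (r.trans s).Homotopic (id G)) :
    ((p.trans r).trans (s.trans q)).Homotopic (id F) := by
  rw [trans_assoc, ← trans_assoc r s q]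
  refine .trans _ _ _ (trans_left p (hrs.trans_right q)) ?_
  rwa [id_trans]

theorem HomotopyEquivalent.trans (h : HomotopyEquivalent F G) (h' : HomotopyEquivalent G H) :
    HomotopyEquivalent F H := by
  obtain ⟨p, q, hpq, hqp⟩ := h
  obtain ⟨r, s, hrs, hsr⟩ := h'
  exact ⟨p.trans r, s.trans q, hpq.trans_trans_trans hrs, hsr.trans_trans_trans hqp⟩

/-- A retraction lying below the identity is a homotopy equivalence. -/
theorem homotopyEquivalent_of_le (F : S ⥤ V) (i : T ⥤ S) (r : S ⥤ T)
    (ε : r ⋙ i ⟶ 𝟭 S) (ε' : i ⋙ r ⟶ 𝟭 T) : HomotopyEquivalent F (i ⋙ F) := by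
  refine ⟨⟨r, Functor.whiskerRight ε F⟩, ⟨i, 𝟙 _⟩, .rel _ _ ⟨ε, fun x => ?_⟩,
    .rel _ _ ⟨ε', fun y => ?_⟩⟩
  · simp [trans, id]
  · simp [trans, id, Subsingleton.elim (ε.app (i.obj y)) (i.map (ε'.app y))]

/-- A retraction lying above the identity, along which all restriction maps are isomorphisms,
is a homotopy equivalence. -/
theorem homotopyEquivalent_of_ge (F : S ⥤ V) (i : T ⥤ S) (r : S ⥤ T)
    (η : 𝟭 S ⟶ r ⋙ i) (η' : 𝟭 T ⟶ i ⋙ r) (hη : ∀ x, IsIso (F.map (η.app x))) :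
    HomotopyEquivalent F (i ⋙ F) := by
  have : ∀ x, IsIso ((Functor.whiskerRight η F).app x) := hη
  have : IsIso (Functor.whiskerRight η F) := NatIso.isIso_of_isIso_app _
  refine ⟨⟨r, inv (Functor.whiskerRight η F)⟩, ⟨i, 𝟙 _⟩,
    .symm _ _ (.rel _ _ ⟨η, fun x => ?_⟩), .symm _ _ (.rel _ _ ⟨η', fun y => ?_⟩)⟩
  · simp [trans, id]
  · simp [trans, id, ← Subsingleton.elim (η.app (i.obj y)) (i.map (η'.app y))]

end Basic

section Rigidity

variable {T : Type} [PartialOrder T] {G : T ⥤ V}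

theorem le_id_iff {p : SheavedHom G G} :
    p ≤ id G ↔ ∃ h : ∀ x, p.base.obj x ≤ x, ∀ x, p.app x = G.map (homOfLE (h x)) := by
  constructor
  · rintro ⟨α, hα⟩
    exact ⟨fun x => leOfHom (α.app x), fun x => (hα x).trans (Category.comp_id _)⟩
  · rintro ⟨h, hh⟩
    exact ⟨{ app := fun x => homOfLE (h x) }, fun x => (hh x).trans (Category.comp_id _).symm⟩

theorem id_le_iff {p : SheavedHom G G} :
    id G ≤ p ↔
      ∃ h : ∀ x, x ≤ p.base.obj x, ∀ x, G.map (homOfLE (h x)) ≫ p.app x = 𝟙 (G.obj x) := by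
  constructor
  · rintro ⟨α, hα⟩
    exact ⟨fun x => leOfHom (α.app x), fun x => (hα x).symm⟩
  · rintro ⟨h, hh⟩
    exact ⟨{ app := fun x => homOfLE (h x) }, fun x => (hh x).symm⟩

theorem id_le_of_le_id [Finite T] (hG : ∀ x, ¬ IsDownbeat (S := T) x) {p : SheavedHom G G}
    (h : p ≤ id G) : id G ≤ p := by
  obtain ⟨hle, hp⟩ := le_id_iff.1 h
  have hfix : ∀ x, p.base.obj x = x := by
    intro x
    induction x using WellFoundedLT.induction with
    | ind x ih =>
      by_contra hne
      refine hG x ⟨p.base.obj x, lt_of_le_of_ne (hle x) hne, fun b hb => ?_⟩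
      rw [← ih b hb]
      exact p.base.monotone hb.le
  refine id_le_iff.2 ⟨fun x => (hfix x).ge, fun x => ?_⟩
  rw [hp, ← G.map_comp, ← G.map_id]
  rfl

theorem le_id_of_id_le [Finite T] (hG : ∀ x, ¬ IsUpbeat G x) {p : SheavedHom G G}
    (h : id G ≤ p) : p ≤ id G := by
  obtain ⟨hle, hp⟩ := id_le_iff.1 h
  have hfix : ∀ x, p.base.obj x = x := by
    intro x
    induction x using WellFoundedGT.induction with
    | ind x ih =>
      by_contra hne
      refine hG x ⟨p.base.obj x, lt_of_le_of_ne (hle x) (Ne.symm hne),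
        fun b hb => ?_, p.app x, hp x, ?_⟩
      · rw [← ih b hb]
        exact p.base.monotone hb.le
      · exact (p.comp.naturality (homOfLE (hle x))).symm.trans (hp (p.base.obj x))
  refine le_id_iff.2 ⟨fun x => (hfix x).le, fun x => ?_⟩
  calc p.app x = G.map (homOfLE (hfix x).le) ≫ G.map (homOfLE (hle x)) ≫ p.app x := by
        rw [← G.map_comp_assoc, Subsingleton.elim (homOfLE _ ≫ homOfLE _) (𝟙 _), G.map_id,
          Category.id_comp]
    _ = _ := by rw [hp, Category.comp_id]

/-- A self-map of a core that is homotopic to the identity is equivalent to the identity. -/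
theorem Homotopic.antisymmRel_id [Finite T] (hG : ∀ x, ¬ IsBeat G x) {p : SheavedHom G G}
    (h : p.Homotopic (id G)) : AntisymmRel (· ≤ ·) p (id G) := by
  have hle {q : SheavedHom G G} : q ≤ id G ↔ id G ≤ q :=
    ⟨id_le_of_le_id fun x hx => hG x (.inr hx), le_id_of_id_le fun x hx => hG x (.inl hx)⟩
  have key : ∀ {a b : SheavedHom G G}, a.Homotopic b → (a ≤ id G ↔ b ≤ id G) := by
    intro a b h
    induction h with
    | rel _ _ h => exact ⟨fun h' => hle.2 ((hle.1 h').trans h), h.trans⟩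
    | refl => exact Iff.rfl
    | symm _ _ _ ih => exact ih.symm
    | trans _ _ _ _ _ ih₁ ih₂ => exact ih₁.trans ih₂
  have := (key h).2 le_rfl
  exact ⟨this, hle.1 this⟩

theorem obj_eq_of_antisymmRel_id {p : SheavedHom G G} (h : AntisymmRel (· ≤ ·) p (id G))
    (x : T) : p.base.obj x = x :=
  le_antisymm ((le_id_iff.1 h.1).1 x) ((id_le_iff.1 h.2).1 x)

theorem isIso_app_of_antisymmRel_id {p : SheavedHom G G} (h : AntisymmRel (· ≤ ·) p (id G))
    (x : T) : IsIso (p.app x) := by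
  obtain ⟨hle, hp⟩ := le_id_iff.1 h.1
  have : IsIso (homOfLE (hle x)) :=
    ⟨homOfLE ((id_le_iff.1 h.2).1 x), Subsingleton.elim _ _, Subsingleton.elim _ _⟩
  rw [hp x]
  infer_instance

/-- Homotopy equivalent cores are isomorphic. -/
theorem HomotopyEquivalent.exists_orderIso {S : Type} [PartialOrder S] [Finite S] [Finite T]
    {F : S ⥤ V} (hF : ∀ x, ¬ IsBeat F x) (hG : ∀ x, ¬ IsBeat G x)
    (h : HomotopyEquivalent F G) :
    ∃ a : S ≃o T, Nonempty ((a.monotone.functor ⋙ G) ≅ F) := by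
  obtain ⟨p, q, hpq, hqp⟩ := h
  have hpq := hpq.antisymmRel_id hF
  have hqp := hqp.antisymmRel_id hG
  have hqp_obj : ∀ x, q.base.obj (p.base.obj x) = x := obj_eq_of_antisymmRel_id hpq
  have hpq_obj : ∀ y, p.base.obj (q.base.obj y) = y := obj_eq_of_antisymmRel_id hqp
  have hiso_obj (y : T) : IsIso (p.app (q.base.obj y)) := by
    have h₁ : IsIso (q.app (p.base.obj (q.base.obj y)) ≫ p.app (q.base.obj y)) :=
      isIso_app_of_antisymmRel_id hpq (q.base.obj y)
    have h₂ : IsIso (p.app (q.base.obj y) ≫ q.app y) := isIso_app_of_antisymmRel_id hqp y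
    have : IsSplitEpi (p.app (q.base.obj y)) :=
      ⟨⟨inv (q.app (p.base.obj (q.base.obj y)) ≫ p.app (q.base.obj y)) ≫ q.app _, by simp⟩⟩
    have : Mono (p.app (q.base.obj y)) := mono_of_mono _ (q.app y)
    exact isIso_of_mono_of_isSplitEpi _
  have hiso (x : S) : IsIso (p.app x) := hqp_obj x ▸ hiso_obj (p.base.obj x)
  let a : S ≃o T :=
    { toFun := p.base.obj
      invFun := q.base.obj
      left_inv := hqp_obj
      right_inv := hpq_obj
      map_rel_iff' := fun {x y} => by
        refine ⟨fun h => ?_, fun h => p.base.monotone h⟩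
        have := q.base.monotone h
        simpa [hqp_obj] using this }
  exact ⟨a, ⟨NatIso.ofComponents (fun x => @asIso _ _ _ _ _ (hiso x))
    fun f => p.comp.naturality f⟩⟩

end Rigidity

end SheavedHom

open SheavedHom

/-- Deleting a beat element does not change the homotopy type. -/
theorem CollapseStep.homotopyEquivalent {S : Type} [PartialOrder S] {F : S ⥤ V} {A B : Set S}
    (h : CollapseStep F A B) :
    HomotopyEquivalent (restrictSheaf (· ∈ A) F) (restrictSheaf (· ∈ B) F) := by
  classical
  obtain ⟨v, hv, hbeat, rfl⟩ := h
  let i : {x // x ∈ A \ {v}} ⥤ {x // x ∈ A} :=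
    Monotone.functor (f := fun x => ⟨x.1, x.2.1⟩) fun _ _ h => h
  let r (a : {x // x ∈ A}) (ha : a.1 ≠ v) (x : {x // x ∈ A}) : {x // x ∈ A \ {v}} :=
    if hx : x.1 = v then ⟨a.1, a.2, ha⟩ else ⟨x.1, x.2, hx⟩
  rcases hbeat with ⟨a, hva, ha, hiso⟩ | ⟨a, hav, ha⟩
  · have hne : a.1 ≠ v := fun h => hva.ne' (Subtype.ext h)
    have hr : Monotone (r a hne) := by
      intro x y hxy
      by_cases hx : x.1 = v <;> by_cases hy : y.1 = v <;>
        simp only [r, hx, hy, dif_pos, dif_neg, not_false_eq_true]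
      · exact le_rfl
      · exact ha y (lt_of_le_of_ne (hx ▸ hxy : v ≤ y.1) fun h => hy (congrArg Subtype.val h).symm)
      · exact (hxy.trans hy.le).trans hva.le
      · exact hxy
    have hη : ∀ x, x ≤ i.obj (r a hne x) := by
      intro x
      by_cases hx : x.1 = v
      · simp only [r, hx, dif_pos]
        exact hx.le.trans hva.le
      · simp only [r, hx, dif_neg, not_false_eq_true]
        exact le_rfl
    refine homotopyEquivalent_of_ge _ i hr.functor { app := fun x => homOfLE (hη x) }
      { app := fun y => homOfLE (hη (i.obj y)) } fun x => ?_
    by_cases hx : x = ⟨v, hv⟩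
    · subst hx
      have key : ∀ b (h : (⟨v, hv⟩ : {x // x ∈ A}) ≤ b), b = a →
          IsIso ((restrictSheaf (· ∈ A) F).map (homOfLE h)) := by
        rintro _ _ rfl
        exact hiso
      exact key _ _ (by simp [i, r]; rfl)
    · have key : ∀ b (h : x ≤ b), b = x →
          IsIso ((restrictSheaf (· ∈ A) F).map (homOfLE h)) := by
        rintro _ _ rfl
        exact inferInstanceAs (IsIso ((restrictSheaf (· ∈ A) F).map (𝟙 _)))
      exact key _ _ (by simp [i, r, Subtype.ext_iff.not.1 hx]; rfl)
  · have hne : a.1 ≠ v := fun h => hav.ne (Subtype.ext h)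
    have hr : Monotone (r a hne) := by
      intro x y hxy
      by_cases hx : x.1 = v <;> by_cases hy : y.1 = v <;>
        simp only [r, hx, hy, dif_pos, dif_neg, not_false_eq_true]
      · exact le_rfl
      · exact hav.le.trans (hx.ge.trans hxy)
      · exact ha x (lt_of_le_of_ne (hy ▸ hxy : x.1 ≤ v) fun h => hx (congrArg Subtype.val h))
      · exact hxy
    have hε : ∀ x, i.obj (r a hne x) ≤ x := by
      intro x
      by_cases hx : x.1 = v
      · simp only [r, hx, dif_pos]
        exact hav.le.trans hx.ge
      · simp only [r, hx, dif_neg, not_false_eq_true]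
        exact le_rfl
    exact homotopyEquivalent_of_le _ i hr.functor { app := fun x => homOfLE (hε x) }
      { app := fun y => homOfLE (hε (i.obj y)) }

theorem IsCoreOf.homotopyEquivalent {S : Type} [PartialOrder S] {F : S ⥤ V} {T : Set S}
    (h : IsCoreOf F T) :
    HomotopyEquivalent (restrictSheaf (· ∈ Set.univ) F) (restrictSheaf (· ∈ T) F) := by
  obtain ⟨h, -⟩ := h
  induction h with
  | refl => exact .refl _
  | tail _ h ih => exact ih.trans h.homotopyEquivalent

/-- All cores of a sheaved space `(S, F)` are isomorphic: if
`(T₁, F|_{T₁})` and `(T₂, F|_{T₂})` are both cores of `(S, F)`, then there is an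
isomorphism of posets `a : T₁ ≃o T₂` together with an isomorphism of sheaves
`a*(F|_{T₂}) ≅ F|_{T₁}`; i.e. the two cores are isomorphic objects of the category of
sheaved spaces. -/
theorem cores_isomorphic
    [Abelian V] {S : Type} [PartialOrder S] [Fintype S] (F : S ⥤ V)
    (T₁ T₂ : Set S) (h₁ : IsCoreOf F T₁) (h₂ : IsCoreOf F T₂) :
    ∃ a : {t : S // t ∈ T₁} ≃o {t : S // t ∈ T₂},
      Nonempty ((a.monotone.functor ⋙ restrictSheaf (· ∈ T₂) F) ≅
        restrictSheaf (· ∈ T₁) F) := by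
  exact (h₁.homotopyEquivalent.symm.trans h₂.homotopyEquivalent).exists_orderIso h₁.2 h₂.2
end
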